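/- There exist absolute constants C > 0 and γ₀ > 0 such that for every γ > γ₀ and every unidirectional Stokes wave solution (ψ, η, r) with R(s_c) < r ≤ R(0), at the crest one has ψ_y(0, η(0)) ≥ √(2γ) − C·γ^(−5/2) and η̂ = η(0) ≤ √(2/γ) + C·γ^(−7/2). -/

import Mathlib

noncomputable section

open Real Set

/-- Partial derivative of `ψ` in the horizontal variable. -/
def px (ψ : ℝ → ℝ → ℝ) (x y : ℝ) : ℝ := deriv (fun t => ψ t y) x

/-- Partial derivative of `ψ` in the vertical variable. -/
def py (ψ : ℝ → ℝ → ℝ) (x y : ℝ) : ℝ := deriv (fun t => ψ x t) y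

/-- Second partial derivative in `x`. -/
def pxx (ψ : ℝ → ℝ → ℝ) (x y : ℝ) : ℝ := deriv (fun t => px ψ t y) x

/-- Second partial derivative in `y`. -/
def pyy (ψ : ℝ → ℝ → ℝ) (x y : ℝ) : ℝ := deriv (fun t => py ψ x t) y

/-- Depth `d(s)` of the laminar (stream) flow with surface value `s` of `ψ_y`. -/
def lamDepth (γ s : ℝ) : ℝ := (-s + Real.sqrt (s ^ 2 + 2 * γ)) / γ

/-- Bernoulli constant `R(s) = ½ s² + γ + d(s)` of the laminar flow. -/
def bernR (γ s : ℝ) : ℝ := s ^ 2 / 2 + γ + lamDepth γ s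

/-- `s` is the (unique) positive critical point `s_c` of `R`, characterized by the
equation `s - 1/γ + s/(γ √(s² + 2γ)) = 0`. -/
def IsCrit (γ s : ℝ) : Prop :=
  0 < s ∧ s - 1 / γ + s / (γ * Real.sqrt (s ^ 2 + 2 * γ)) = 0

/-- A solution `(ψ, η, r)` of the stream-function formulation with constant adverse
vorticity `ω = -γ`:  `Δψ = γ` in the fluid domain `D_η`, the Bernoulli condition on the
surface, `ψ = 1` on the surface and `ψ = 0` on the flat bottom. -/
structure StreamSolution (γ : ℝ) (ψ : ℝ → ℝ → ℝ) (η : ℝ → ℝ) (r : ℝ) : Prop where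
  eta_smooth : ContDiff ℝ (⊤ : ℕ∞) η
  eta_pos : ∀ x, 0 < η x
  psi_smooth : ContDiff ℝ (⊤ : ℕ∞) (fun p : ℝ × ℝ => ψ p.1 p.2)
  laplace : ∀ x y, 0 < y → y < η x → pxx ψ x y + pyy ψ x y = γ
  bernoulli : ∀ x, (px ψ x (η x)) ^ 2 / 2 + (py ψ x (η x)) ^ 2 / 2 + η x = r
  surface_val : ∀ x, ψ x (η x) = 1
  bottom_val : ∀ x, ψ x 0 = 0

/-- The flow is unidirectional: `ψ_y > 0` everywhere in the fluid domain `D_η`. -/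
def Unidirectional (ψ : ℝ → ℝ → ℝ) (η : ℝ → ℝ) : Prop :=
  ∀ x y, 0 < y → y < η x → 0 < py ψ x y

/-- A Stokes wave with half-period `Λ`: the solution is `2Λ`-periodic and even in `x`,
and the surface profile is strictly decreasing from the crest (`x = 0`) to the
trough (`x = Λ`).  Thus `η̂ = max η = η 0` and `η̌ = min η = η Λ`. -/
structure StokesWave (γ : ℝ) (ψ : ℝ → ℝ → ℝ) (η : ℝ → ℝ) (r Λ : ℝ) : Prop where
  sol : StreamSolution γ ψ η r
  lam_pos : 0 < Λ
  eta_periodic : ∀ x, η (x + 2 * Λ) = η x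
  eta_even : ∀ x, η (-x) = η x
  psi_periodic : ∀ x y, ψ (x + 2 * Λ) y = ψ x y
  psi_even : ∀ x y, ψ (-x) y = ψ x y
  eta_anti : StrictAntiOn η (Set.Icc 0 Λ)

/-- A solitary wave (relative to the critical value `sc = s_c` of `γ`): the solution is
even in `x`, the profile is strictly decreasing on `(0, ∞)` and non-constant, and the
flow converges to a supercritical laminar flow `(U(·; s), d(s))` with `s > s_c`,
`R(s) = r` as `|x| → ∞`.  The crest is at `x = 0`, `η̂ = η 0` and `η̌ = inf η = d(s)`. -/
structure SolitaryWave (γ sc : ℝ) (ψ : ℝ → ℝ → ℝ) (η : ℝ → ℝ) (r : ℝ) : Prop where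
  sol : StreamSolution γ ψ η r
  eta_even : ∀ x, η (-x) = η x
  psi_even : ∀ x y, ψ (-x) y = ψ x y
  eta_anti : StrictAntiOn η (Set.Ioi 0)
  nonconst : ∃ x₁ x₂, η x₁ ≠ η x₂
  asymptotic : ∃ s, sc < s ∧ bernR γ s = r ∧
    ∀ ε > 0, ∃ X : ℝ, ∀ x : ℝ, X ≤ |x| →
      |η x - lamDepth γ s| ≤ ε ∧
      ∀ y ∈ Set.Icc 0 (η x), |px ψ x y| + |py ψ x y - (γ * y + s)| ≤ ε

/-- Joint smoothness of a function of two real variables. -/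
def Sm (u : ℝ → ℝ → ℝ) : Prop := ContDiff ℝ (⊤ : ℕ∞) (fun p : ℝ × ℝ => u p.1 p.2)

lemma Sm.slx {u : ℝ → ℝ → ℝ} (h : Sm u) (y : ℝ) : ContDiff ℝ (⊤ : ℕ∞) (fun t => u t y) :=
  ContDiff.comp (g := fun p : ℝ × ℝ => u p.1 p.2) h (contDiff_id.prodMk contDiff_const)

lemma Sm.sly {u : ℝ → ℝ → ℝ} (h : Sm u) (x : ℝ) : ContDiff ℝ (⊤ : ℕ∞) (fun t => u x t) :=
  ContDiff.comp (g := fun p : ℝ × ℝ => u p.1 p.2) h (contDiff_const.prodMk contDiff_id)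

lemma Sm.hfd {u : ℝ → ℝ → ℝ} (h : Sm u) (p : ℝ × ℝ) :
    HasFDerivAt (fun p : ℝ × ℝ => u p.1 p.2) (fderiv ℝ (fun p : ℝ × ℝ => u p.1 p.2) p) p :=
  ((ContDiff.differentiable h (by simp)) p).hasFDerivAt

lemma Sm.px_eq {u : ℝ → ℝ → ℝ} (h : Sm u) (x y : ℝ) :
    px u x y = fderiv ℝ (fun p : ℝ × ℝ => u p.1 p.2) (x, y) (1, 0) := by
  have h1 : HasDerivAt (fun t : ℝ => (t, y)) ((1 : ℝ), (0 : ℝ)) x :=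
    (hasDerivAt_id x).prodMk (hasDerivAt_const x y)
  exact (HasFDerivAt.comp_hasDerivAt x (h.hfd (x, y)) h1).deriv

lemma Sm.py_eq {u : ℝ → ℝ → ℝ} (h : Sm u) (x y : ℝ) :
    py u x y = fderiv ℝ (fun p : ℝ × ℝ => u p.1 p.2) (x, y) (0, 1) := by
  have h1 : HasDerivAt (fun t : ℝ => (x, t)) ((0 : ℝ), (1 : ℝ)) y :=
    (hasDerivAt_const y x).prodMk (hasDerivAt_id y)
  exact (HasFDerivAt.comp_hasDerivAt y (h.hfd (x, y)) h1).deriv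

lemma Sm.spx {u : ℝ → ℝ → ℝ} (h : Sm u) : Sm (px u) := by
  have h1 : ContDiff ℝ (⊤ : ℕ∞) (fderiv ℝ (fun p : ℝ × ℝ => u p.1 p.2)) :=
    ContDiff.fderiv_right h (by simp)
  have h2 := h1.clm_apply (contDiff_const (c := ((1 : ℝ), (0 : ℝ))))
  unfold Sm
  convert h2 using 2 with p
  exact h.px_eq p.1 p.2

lemma Sm.spy {u : ℝ → ℝ → ℝ} (h : Sm u) : Sm (py u) := by
  have h1 : ContDiff ℝ (⊤ : ℕ∞) (fderiv ℝ (fun p : ℝ × ℝ => u p.1 p.2)) :=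
    ContDiff.fderiv_right h (by simp)
  have h2 := h1.clm_apply (contDiff_const (c := ((0 : ℝ), (1 : ℝ))))
  unfold Sm
  convert h2 using 2 with p
  exact h.py_eq p.1 p.2

lemma Sm.comm {u : ℝ → ℝ → ℝ} (h : Sm u) (x y : ℝ) : px (py u) x y = py (px u) x y := by
  have h1 : ContDiff ℝ (⊤ : ℕ∞) (fderiv ℝ (fun p : ℝ × ℝ => u p.1 p.2)) :=
    ContDiff.fderiv_right h (by simp)
  have hd : HasFDerivAt (fderiv ℝ (fun p : ℝ × ℝ => u p.1 p.2))
      (fderiv ℝ (fderiv ℝ (fun p : ℝ × ℝ => u p.1 p.2)) (x, y)) (x, y) :=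
    ((h1.differentiable (by simp)) (x, y)).hasFDerivAt
  have hs : IsSymmSndFDerivAt ℝ (fun p : ℝ × ℝ => u p.1 p.2) (x, y) :=
    (ContDiff.contDiffAt h).isSymmSndFDerivAt (by
      rw [minSmoothness_of_isRCLikeNormedField]; exact WithTop.coe_le_coe.2 (le_top : (2 : ℕ∞) ≤ ⊤))
  have e1 : px (py u) x y
      = fderiv ℝ (fderiv ℝ (fun p : ℝ × ℝ => u p.1 p.2)) (x, y) (1, 0) (0, 1) := by
    have : (fun t => py u t y)
        = fun t => fderiv ℝ (fun p : ℝ × ℝ => u p.1 p.2) (t, y) (0, 1) := by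
      funext t; exact h.py_eq t y
    show deriv (fun t => py u t y) x = _
    rw [this]
    have h2 : HasDerivAt (fun t : ℝ => (t, y)) ((1 : ℝ), (0 : ℝ)) x :=
      (hasDerivAt_id x).prodMk (hasDerivAt_const x y)
    have h3 := HasFDerivAt.comp_hasDerivAt x hd h2
    have h4 := h3.clm_apply (hasDerivAt_const x ((0 : ℝ), (1 : ℝ)))
    simpa using h4.deriv
  have e2 : py (px u) x y
      = fderiv ℝ (fderiv ℝ (fun p : ℝ × ℝ => u p.1 p.2)) (x, y) (0, 1) (1, 0) := by
    have : (fun t => px u x t)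
        = fun t => fderiv ℝ (fun p : ℝ × ℝ => u p.1 p.2) (x, t) (1, 0) := by
      funext t; exact h.px_eq x t
    show deriv (fun t => px u x t) y = _
    rw [this]
    have h2 : HasDerivAt (fun t : ℝ => (x, t)) ((0 : ℝ), (1 : ℝ)) y :=
      (hasDerivAt_const y x).prodMk (hasDerivAt_id y)
    have h3 := HasFDerivAt.comp_hasDerivAt y hd h2
    have h4 := h3.clm_apply (hasDerivAt_const y ((1 : ℝ), (0 : ℝ)))
    simpa using h4.deriv
  rw [e1, e2]
  exact hs _ _

lemma Sm.hdx {u : ℝ → ℝ → ℝ} (h : Sm u) (x y : ℝ) :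
    HasDerivAt (fun t => u t y) (px u x y) x :=
  (((h.slx y).differentiable (by simp)) x).hasDerivAt

lemma Sm.hdy {u : ℝ → ℝ → ℝ} (h : Sm u) (x y : ℝ) :
    HasDerivAt (fun t => u x t) (py u x y) y :=
  (((h.sly x).differentiable (by simp)) y).hasDerivAt

/-- Derivative of `u` along a graph. -/
lemma Sm.along {u : ℝ → ℝ → ℝ} (h : Sm u) {f : ℝ → ℝ} {f' x : ℝ} (hf : HasDerivAt f f' x) :
    HasDerivAt (fun t => u t (f t)) (px u x (f x) + f' * py u x (f x)) x := by
  have h1 : HasDerivAt (fun t : ℝ => (t, f t)) ((1 : ℝ), f') x :=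
    (hasDerivAt_id x).prodMk hf
  have h2 := HasFDerivAt.comp_hasDerivAt x (h.hfd (x, f x)) h1
  have h3 : ((1 : ℝ), f') = (1, 0) + f' • ((0 : ℝ), (1 : ℝ)) := by simp
  rw [h3, map_add, map_smul, ← h.px_eq, ← h.py_eq] at h2
  simp only [smul_eq_mul] at h2
  exact h2

lemma dd_nonpos {f : ℝ → ℝ} {x : ℝ} (hc : ContinuousAt f x) (hm : IsLocalMax f x) :
    deriv (deriv f) x ≤ 0 := by
  by_contra hcon
  push Not at hcon
  have hmin := isLocalMin_of_deriv_deriv_pos hcon hm.deriv_eq_zero hc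
  have he : f =ᶠ[nhds x] fun _ => f x := by
    filter_upwards [hm, hmin] with t h1 h2
    exact le_antisymm h1 h2
  have h2 : deriv f =ᶠ[nhds x] deriv (fun _ => f x) := he.deriv
  have h3 := h2.deriv_eq
  simp at h3
  linarith

lemma dd_add_sq {f : ℝ → ℝ} (hf : ContDiff ℝ (⊤ : ℕ∞) f) (ε x : ℝ) :
    deriv (deriv (fun t => f t + ε * t ^ 2)) x = deriv (deriv f) x + 2 * ε := by
  have e : deriv (fun t => f t + ε * t ^ 2) = fun t => deriv f t + 2 * ε * t := by
    funext t
    have h1 : HasDerivAt (fun t : ℝ => ε * t ^ 2) (2 * ε * t) t := by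
      exact ((hasDerivAt_pow 2 t).const_mul ε).congr_deriv (by push_cast; ring)
    exact ((hf.differentiable (by simp) t).hasDerivAt.add h1).deriv
  rw [e]
  have hd : Differentiable ℝ (deriv f) :=
    (hf.iterate_deriv 1).differentiable (by simp)
  have h1 : HasDerivAt (fun t : ℝ => 2 * ε * t) (2 * ε) x := by
    simpa using (hasDerivAt_id x).const_mul (2 * ε)
  exact ((hd x).hasDerivAt.add h1).deriv

/-- Weak maximum principle. -/
lemma wmp {u : ℝ → ℝ → ℝ} (hu : Sm u) (N K : Set (ℝ × ℝ)) (hK : IsCompact K) (hKN : K ⊆ N)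
    (hrep : ∀ p ∈ N, ∃ p' ∈ K, p'.2 = p.2 ∧ u p'.1 p'.2 = u p.1 p.2)
    (hN : ∀ p ∈ N, u p.1 p.2 ≤ 0 ∨ (N ∈ nhds p ∧ 0 ≤ pxx u p.1 p.2 + pyy u p.1 p.2)) :
    ∀ p ∈ N, u p.1 p.2 ≤ 0 := by
  intro p0 hp0
  by_contra hcon
  push Not at hcon
  obtain ⟨p1, hp1K, hp1y, hp1u⟩ := hrep p0 hp0
  obtain ⟨pm, hpm, hM⟩ := hK.exists_isMaxOn ⟨p1, hp1K⟩
    (f := fun p : ℝ × ℝ => p.2 ^ 2) (by fun_prop)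
  set M := pm.2 ^ 2 with hMdef
  have hM0 : 0 ≤ M := sq_nonneg _
  set ε := u p0.1 p0.2 / (2 * (M + 1)) with hε
  have hεpos : 0 < ε := by positivity
  have hεM : ε * M < u p0.1 p0.2 := by
    rw [hε, div_mul_eq_mul_div, div_lt_iff₀ (by positivity)]
    nlinarith
  have hcu : Continuous (fun p : ℝ × ℝ => u p.1 p.2) := ContDiff.continuous hu
  obtain ⟨p, hpK, hmax⟩ := hK.exists_isMaxOn ⟨p1, hp1K⟩
    (f := fun p : ℝ × ℝ => u p.1 p.2 + ε * p.2 ^ 2) (by fun_prop)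
  have h1 := hmax hp1K
  have h2 := hM hpK
  simp only [mem_ofPred_eq] at h1 h2
  have hpos : 0 < u p.1 p.2 := by
    have : 0 ≤ ε * p1.2 ^ 2 := by positivity
    have : ε * p.2 ^ 2 ≤ ε * M := mul_le_mul_of_nonneg_left h2 hεpos.le
    rw [hp1u] at h1
    linarith
  rcases hN p (hKN hpK) with h | ⟨hnb, hlap⟩
  · linarith
  have hloc : ∀ᶠ z in nhds p, u z.1 z.2 + ε * z.2 ^ 2 ≤ u p.1 p.2 + ε * p.2 ^ 2 := by
    filter_upwards [hnb] with z hz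
    obtain ⟨z', hz', e1, e2⟩ := hrep z hz
    have := hmax hz'
    simp only [mem_ofPred_eq] at this
    rw [e2, e1] at this
    exact this
  have hx : pxx u p.1 p.2 ≤ 0 := by
    apply dd_nonpos (f := fun t => u t p.2) ((hu.slx p.2).continuous.continuousAt)
    have hc : Filter.Tendsto (fun t : ℝ => (t, p.2)) (nhds p.1) (nhds p) := by
      have : Continuous (fun t : ℝ => (t, p.2)) := by fun_prop
      exact this.tendsto p.1
    filter_upwards [hc.eventually hloc] with t ht
    simpa using ht
  have hy : pyy u p.1 p.2 + 2 * ε ≤ 0 := by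
    have := dd_add_sq (hu.sly p.1) ε p.2
    have h3 : deriv (deriv (fun t => u p.1 t + ε * t ^ 2)) p.2 ≤ 0 := by
      apply dd_nonpos
      · have := (hu.sly p.1).continuous
        fun_prop
      have hc : Filter.Tendsto (fun t : ℝ => (p.1, t)) (nhds p.2) (nhds p) := by
        have : Continuous (fun t : ℝ => (p.1, t)) := by fun_prop
        exact this.tendsto p.2
      filter_upwards [hc.eventually hloc] with t ht
      simpa using ht
    rw [this] at h3
    exact h3
  linarith

/-- Weak maximum principle on a compact set. -/
lemma wmpc {u : ℝ → ℝ → ℝ} (hu : Sm u) (N : Set (ℝ × ℝ)) (hK : IsCompact N)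
    (hN : ∀ p ∈ N, u p.1 p.2 ≤ 0 ∨ (N ∈ nhds p ∧ 0 ≤ pxx u p.1 p.2 + pyy u p.1 p.2)) :
    ∀ p ∈ N, u p.1 p.2 ≤ 0 :=
  wmp hu N N hK Subset.rfl (fun p hp => ⟨p, hp, rfl, rfl⟩) hN

lemma cpt {η : ℝ → ℝ} (hη : Continuous η) (a b c : ℝ) :
    IsCompact {p : ℝ × ℝ | a ≤ p.1 ∧ p.1 ≤ b ∧ c ≤ p.2 ∧ p.2 ≤ η p.1} := by
  obtain ⟨M, hM⟩ := (isCompact_Icc (a := a) (b := b)).bddAbove_image hη.continuousOn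
  refine IsCompact.of_isClosed_subset (isCompact_Icc.prod isCompact_Icc)
    (s := Icc a b ×ˢ Icc c M) ?_ ?_
  · refine IsClosed.inter (isClosed_le continuous_const continuous_fst) (IsClosed.inter
      (isClosed_le continuous_fst continuous_const) (IsClosed.inter
      (isClosed_le continuous_const continuous_snd)
      (isClosed_le continuous_snd (hη.comp continuous_fst))))
  · rintro ⟨x, y⟩ ⟨h1, h2, h3, h4⟩
    exact ⟨⟨h1, h2⟩, h3, h4.trans (hM ⟨x, ⟨h1, h2⟩, rfl⟩)⟩

section wave

variable {γ : ℝ} {ψ : ℝ → ℝ → ℝ} {η : ℝ → ℝ} {r Λ : ℝ}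

lemma StokesWave.sm (W : StokesWave γ ψ η r Λ) : Sm ψ := W.sol.psi_smooth

lemma StokesWave.etac (W : StokesWave γ ψ η r Λ) : Continuous η := W.sol.eta_smooth.continuous

lemma py_nonneg (W : StokesWave γ ψ η r Λ) (U : Unidirectional ψ η) {x y : ℝ} (h0 : 0 ≤ y)
    (h1 : y ≤ η x) : 0 ≤ py ψ x y := by
  have hc : Continuous (fun t => py ψ x t) := (W.sm.spy.sly x).continuous
  have hcl : closure (Ioo 0 (η x)) ⊆ (fun t => py ψ x t) ⁻¹' (Ici 0) :=
    (isClosed_Ici.preimage hc).closure_subset_iff.2 (fun t ht => (U x t ht.1 ht.2).le)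
  rw [closure_Ioo (W.sol.eta_pos x).ne] at hcl
  exact hcl ⟨h0, h1⟩

lemma px_neg (W : StokesWave γ ψ η r Λ) (x y : ℝ) : px ψ (-x) y = - px ψ x y := by
  have h : (fun t => ψ t y) = fun t => ψ (-t) y := by funext t; exact (W.psi_even t y).symm
  have h2 : deriv (fun t => ψ t y) x = - deriv (fun t => ψ t y) (-x) := by
    conv_lhs => rw [h]
    exact deriv_comp_neg (fun t => ψ t y) x
  show deriv (fun t => ψ t y) (-x) = - deriv (fun t => ψ t y) x
  linarith

lemma px_zero (W : StokesWave γ ψ η r Λ) (y : ℝ) : px ψ 0 y = 0 := by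
  have := px_neg W 0 y
  rw [neg_zero] at this
  linarith

lemma px_lam (W : StokesWave γ ψ η r Λ) (y : ℝ) : px ψ Λ y = 0 := by
  have h1 := px_neg W Λ y
  have h : (fun t => ψ t y) = fun t => ψ (t + 2 * Λ) y := by
    funext t; exact (W.psi_periodic t y).symm
  have h2 : deriv (fun t => ψ t y) (-Λ) = deriv (fun t => ψ t y) (-Λ + 2 * Λ) := by
    conv_lhs => rw [h]
    exact deriv_comp_add_const (f := fun t => ψ t y) (2 * Λ) (-Λ)
  rw [show -Λ + 2 * Λ = Λ by ring] at h2
  change px ψ (-Λ) y = px ψ Λ y at h2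
  linarith

lemma px_bot (W : StokesWave γ ψ η r Λ) (x : ℝ) : px ψ x 0 = 0 := by
  have h : (fun t => ψ t 0) = fun _ => (0 : ℝ) := by funext t; exact W.sol.bottom_val t
  show deriv (fun t => ψ t 0) x = 0
  rw [h]; simp

lemma px_surf (W : StokesWave γ ψ η r Λ) (x : ℝ) :
    px ψ x (η x) + deriv η x * py ψ x (η x) = 0 := by
  have hη : HasDerivAt η (deriv η x) x :=
    ((W.sol.eta_smooth.differentiable (by simp)) x).hasDerivAt
  have h1 := W.sm.along hη
  have h2 : (fun t => ψ t (η t)) = fun _ => (1 : ℝ) := by funext t; exact W.sol.surface_val t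
  rw [h2] at h1
  exact h1.unique (hasDerivAt_const x 1)

lemma deriv_eta_nonpos (W : StokesWave γ ψ η r Λ) {x : ℝ} (h : x ∈ Ioo 0 Λ) :
    deriv η x ≤ 0 := by
  have h1 := (W.eta_anti.antitoneOn).derivWithin_nonpos (x := x)
  rwa [derivWithin_of_mem_nhds (Icc_mem_nhds h.1 h.2)] at h1

lemma harm_px (W : StokesWave γ ψ η r Λ) {x y : ℝ} (h0 : 0 < y) (h1 : y < η x) :
    pxx (px ψ) x y + pyy (px ψ) x y = 0 := by
  have hs := W.sm
  have e1 : pyy (px ψ) x y = px (pyy ψ) x y := by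
    have a1 : py (px ψ) = px (py ψ) := by
      funext s t; exact (hs.comm s t).symm
    show py (py (px ψ)) x y = px (py (py ψ)) x y
    rw [a1, hs.spy.comm]
  have e2 : pxx (px ψ) x y = px (pxx ψ) x y := rfl
  have d1 : HasDerivAt (fun t => pxx ψ t y) (px (pxx ψ) x y) x := (hs.spx.spx).hdx x y
  have d2 : HasDerivAt (fun t => pyy ψ t y) (px (pyy ψ) x y) x := (hs.spy.spy).hdx x y
  have d3 := d1.add d2
  rw [e1, e2]
  have hev : ((fun t => pxx ψ t y) + fun t => pyy ψ t y) =ᶠ[nhds x] fun _ => γ := by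
    have : ∀ᶠ t in nhds x, y < η t := W.etac.continuousAt.eventually (lt_mem_nhds h1)
    filter_upwards [this] with t ht
    exact W.sol.laplace t y h0 ht
  have := d3.congr_of_eventuallyEq hev.symm
  exact this.unique (hasDerivAt_const x γ)

lemma nhds_dom {η : ℝ → ℝ} (hη : Continuous η) {a b c : ℝ} {p : ℝ × ℝ} (h1 : a < p.1) (h2 : p.1 < b)
    (h3 : c < p.2) (h4 : p.2 < η p.1) :
    {p : ℝ × ℝ | a ≤ p.1 ∧ p.1 ≤ b ∧ c ≤ p.2 ∧ p.2 ≤ η p.1} ∈ nhds p := by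
  have e1 : ∀ᶠ z : ℝ × ℝ in nhds p, a < z.1 := continuous_fst.continuousAt.eventually (lt_mem_nhds h1)
  have e2 : ∀ᶠ z : ℝ × ℝ in nhds p, z.1 < b := continuous_fst.continuousAt.eventually (gt_mem_nhds h2)
  have e3 : ∀ᶠ z : ℝ × ℝ in nhds p, c < z.2 := continuous_snd.continuousAt.eventually (lt_mem_nhds h3)
  have e4 : ∀ᶠ z : ℝ × ℝ in nhds p, z.2 < η z.1 :=
    (continuous_snd.continuousAt).eventually_lt ((hη.comp continuous_fst).continuousAt) h4
  filter_upwards [e1, e2, e3, e4] with z z1 z2 z3 z4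
  exact ⟨z1.le, z2.le, z3.le, z4.le⟩

lemma dd_neg (f : ℝ → ℝ) (x : ℝ) : deriv (deriv (fun t => - f t)) x = - deriv (deriv f) x := by
  have : deriv (fun t => - f t) = fun t => - deriv f t := by
    funext t; exact deriv.fun_neg
  rw [this]; exact deriv.fun_neg

lemma px_nonneg (W : StokesWave γ ψ η r Λ) (U : Unidirectional ψ η) {x y : ℝ} (hx0 : 0 ≤ x)
    (hx1 : x ≤ Λ) (h0 : 0 ≤ y) (h1 : y ≤ η x) : 0 ≤ px ψ x y := by
  have hs : Sm (fun x y => - px ψ x y) := ContDiff.neg W.sm.spx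
  have key := wmpc hs _ (cpt W.etac 0 Λ 0) (fun p hp => ?_) (x, y) ⟨hx0, hx1, h0, h1⟩
  · simpa using key
  obtain ⟨q1, q2, q3, q4⟩ := hp
  rcases q1.eq_or_lt with e | q1'
  · left; rw [← e, px_zero W]; simp
  rcases q2.eq_or_lt with e | q2'
  · left; rw [e, px_lam W]; simp
  rcases q3.eq_or_lt with e | q3'
  · left; rw [← e, px_bot W]; simp
  rcases q4.eq_or_lt with e | q4'
  · left
    have a := px_surf W p.1
    have b := deriv_eta_nonpos W ⟨q1', q2'⟩
    have c := py_nonneg W U (x := p.1) (W.sol.eta_pos p.1).le le_rfl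
    rw [e]
    nlinarith [mul_nonneg (neg_nonneg.2 b) c]
  · right
    refine ⟨nhds_dom W.etac q1' q2' q3' q4', ?_⟩
    have a := harm_px W q3' q4'
    have b1 := dd_neg (fun t => px ψ t p.2) p.1
    have b2 := dd_neg (fun t => px ψ p.1 t) p.2
    change pxx (fun x y => - px ψ x y) p.1 p.2 = - pxx (px ψ) p.1 p.2 at b1
    change pyy (fun x y => - px ψ x y) p.1 p.2 = - pyy (px ψ) p.1 p.2 at b2
    rw [b1, b2]; linarith

lemma dd_sub_const (f : ℝ → ℝ) (c x : ℝ) :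
    deriv (deriv (fun t => f t - c)) x = deriv (deriv f) x := by
  have : deriv (fun t => f t - c) = deriv f := by
    funext t; exact deriv_sub_const c
  rw [this]

lemma r_pos (W : StokesWave γ ψ η r Λ) : 0 < r := by
  have := W.sol.bernoulli 0
  have := W.sol.eta_pos 0
  have := sq_nonneg (px ψ 0 (η 0))
  have := sq_nonneg (py ψ 0 (η 0))
  linarith

lemma px_le (W : StokesWave γ ψ η r Λ) {x y : ℝ} (hx0 : 0 ≤ x)
    (hx1 : x ≤ Λ) (h0 : 0 ≤ y) (h1 : y ≤ η x) : px ψ x y ≤ √(2 * r) := by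
  have hs : Sm (fun x y => px ψ x y - √(2 * r)) := ContDiff.sub W.sm.spx contDiff_const
  have hsq : 0 ≤ √(2 * r) := Real.sqrt_nonneg _
  have key := wmpc hs _ (cpt W.etac 0 Λ 0) (fun p hp => ?_) (x, y) ⟨hx0, hx1, h0, h1⟩
  · simpa using key
  obtain ⟨q1, q2, q3, q4⟩ := hp
  rcases q1.eq_or_lt with e | q1'
  · left; rw [← e, px_zero W]; simp
  rcases q2.eq_or_lt with e | q2'
  · left; rw [e, px_lam W]; simp
  rcases q3.eq_or_lt with e | q3'
  · left; rw [← e, px_bot W]; simp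
  rcases q4.eq_or_lt with e | q4'
  · left
    have a := W.sol.bernoulli p.1
    have c := W.sol.eta_pos p.1
    rw [e]
    have := Real.le_sqrt_of_sq_le (x := px ψ p.1 (η p.1)) (y := 2 * r)
      (by nlinarith [sq_nonneg (py ψ p.1 (η p.1))])
    linarith
  · right
    refine ⟨nhds_dom W.etac q1' q2' q3' q4', ?_⟩
    have a := harm_px W q3' q4'
    have b1 := dd_sub_const (fun t => px ψ t p.2) (√(2 * r)) p.1
    have b2 := dd_sub_const (fun t => px ψ p.1 t) (√(2 * r)) p.2
    change pxx (fun x y => px ψ x y - √(2 * r)) p.1 p.2 = pxx (px ψ) p.1 p.2 at b1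
    change pyy (fun x y => px ψ x y - √(2 * r)) p.1 p.2 = pyy (px ψ) p.1 p.2 at b2
    rw [b1, b2]; linarith

/-- derivative comparison at the left end point -/
lemma deriv_nonneg_left {f : ℝ → ℝ} {f' a b : ℝ} (hab : a < b) (hd : HasDerivAt f f' a)
    (hf : ∀ t ∈ Icc a b, f a ≤ f t) : 0 ≤ f' := by
  by_contra hc
  push Not at hc
  have h1 := hd.hasDerivWithinAt (s := Ioi a)
  rw [hasDerivWithinAt_iff_tendsto_slope' (by simp)] at h1
  have h2 := h1.eventually (gt_mem_nhds hc)
  have h3 : ∀ᶠ t in nhdsWithin a (Ioi a), t ∈ Ioo a b := Ioo_mem_nhdsGT hab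
  obtain ⟨t, ht1, ht2⟩ := (h2.and h3).exists
  have := hf t ⟨ht2.1.le, ht2.2.le⟩
  rw [slope_def_field] at ht1
  have : 0 ≤ (f t - f a) / (t - a) := div_nonneg (by linarith) (by linarith [ht2.1])
  linarith

lemma deriv_nonpos_left {f : ℝ → ℝ} {f' a b : ℝ} (hab : a < b) (hd : HasDerivAt f f' a)
    (hf : ∀ t ∈ Icc a b, f t ≤ f a) : f' ≤ 0 := by
  have := deriv_nonneg_left hab hd.neg (fun t ht => by simpa using hf t ht)
  linarith

lemma deriv_nonneg_right {f : ℝ → ℝ} {f' a b : ℝ} (hab : a < b) (hd : HasDerivAt f f' b)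
    (hf : ∀ t ∈ Icc a b, f t ≤ f b) : 0 ≤ f' := by
  have h1 : HasDerivAt (fun t => f (-t)) (-f') (-b) := by
    have : HasDerivAt f f' (- -b) := by simpa using hd
    exact (HasDerivAt.comp (-b) this (hasDerivAt_neg (-b))).congr_deriv (by ring)
  have := deriv_nonpos_left (neg_lt_neg hab) h1 (fun t ht => by
    simpa using hf (-t) ⟨by linarith [ht.2], by linarith [ht.1]⟩)
  linarith

lemma dd_add {f g : ℝ → ℝ} (hf : ContDiff ℝ (⊤ : ℕ∞) f) (hg : ContDiff ℝ (⊤ : ℕ∞) g) (x : ℝ) :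
    deriv (deriv (fun t => f t + g t)) x = deriv (deriv f) x + deriv (deriv g) x := by
  have e : deriv (fun t => f t + g t) = fun t => deriv f t + deriv g t := by
    funext t
    exact ((hf.differentiable (by simp) t).hasDerivAt.add
      (hg.differentiable (by simp) t).hasDerivAt).deriv
  rw [e]
  have hd : Differentiable ℝ (deriv f) := (hf.iterate_deriv 1).differentiable (by simp)
  have hd2 : Differentiable ℝ (deriv g) := (hg.iterate_deriv 1).differentiable (by simp)
  exact ((hd x).hasDerivAt.add (hd2 x).hasDerivAt).deriv

lemma dd_quad {f : ℝ → ℝ} (hf : ContDiff ℝ (⊤ : ℕ∞) f) (A B C x : ℝ) :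
    deriv (deriv (fun t => f t + (A * t ^ 2 + B * t + C))) x = deriv (deriv f) x + 2 * A := by
  rw [dd_add hf (by fun_prop)]
  congr 1
  have e : deriv (fun t : ℝ => A * t ^ 2 + B * t + C) = fun t => 2 * A * t + B := by
    funext t
    have h := (((hasDerivAt_pow 2 t).const_mul A).add ((hasDerivAt_id t).const_mul B)).add_const C
    exact (h.congr_deriv (by push_cast; ring)).deriv
  rw [e]
  have h := ((hasDerivAt_id x).const_mul (2 * A)).add_const B
  exact (h.congr_deriv (by ring)).deriv

lemma eta_rep (W : StokesWave γ ψ η r Λ) (x : ℝ) :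
    ∃ x' ∈ Icc 0 (2 * Λ), η x' = η x ∧ ∀ y, ψ x' y = ψ x y := by
  have hp : Function.Periodic (fun x => (ψ x, η x)) (2 * Λ) := by
    intro x
    simp only [Prod.mk.injEq]
    exact ⟨funext fun y => W.psi_periodic x y, W.eta_periodic x⟩
  obtain ⟨x', hx', he⟩ := hp.exists_mem_Ico₀ (by linarith [W.lam_pos]) x
  simp only [Prod.mk.injEq] at he
  exact ⟨x', ⟨hx'.1, hx'.2.le⟩, he.2.symm, fun y => (congrFun he.1 y).symm⟩

lemma eta_min (W : StokesWave γ ψ η r Λ) (x : ℝ) : η Λ ≤ η x := by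
  obtain ⟨x', ⟨h1, h2⟩, he, -⟩ := eta_rep W x
  have hl := W.lam_pos
  rw [← he]
  rcases le_total x' Λ with h | h
  · exact W.eta_anti.antitoneOn ⟨h1, h⟩ ⟨hl.le, le_rfl⟩ h
  · have : η x' = η (2 * Λ - x') := by
      rw [← W.eta_even x', ← W.eta_periodic (-x')]
      congr 1; ring
    rw [this]
    exact W.eta_anti.antitoneOn ⟨by linarith, by linarith⟩ ⟨hl.le, le_rfl⟩ (by linarith)

lemma psi_le (W : StokesWave γ ψ η r Λ) (hγ : 0 < γ) {β : ℝ}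
    (hβ : γ * (η Λ) ^ 2 / 2 + β * η Λ = 1) {x y : ℝ} (h0 : 0 ≤ y) (h1 : y ≤ η x) :
    ψ x y ≤ γ * y ^ 2 / 2 + β * y := by
  have hs : Sm (fun x y => ψ x y + ((-γ / 2) * y ^ 2 + (-β) * y + 0)) :=
    ContDiff.add W.sm (by fun_prop)
  have key := wmp hs {p | 0 ≤ p.2 ∧ p.2 ≤ η p.1} _ (cpt W.etac 0 (2 * Λ) 0)
    (fun p hp => ⟨hp.2.2.1, hp.2.2.2⟩) (fun p hp => ?_) (fun p hp => ?_) (x, y) ⟨h0, h1⟩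
  · simp only at key; linarith
  · obtain ⟨x', hx', he, hψ⟩ := eta_rep W p.1
    refine ⟨(x', p.2), ⟨hx'.1, hx'.2, hp.1, ?_⟩, rfl, ?_⟩
    · simp only; rw [he]; exact hp.2
    · simp only; rw [hψ]
  · obtain ⟨q3, q4⟩ := hp
    rcases q3.eq_or_lt with e | q3'
    · left; rw [← e, W.sol.bottom_val]; simp
    rcases q4.eq_or_lt with e | q4'
    · left
      rw [e, W.sol.surface_val]
      have a := eta_min W p.1
      have b := W.sol.eta_pos Λ
      have c := W.sol.eta_pos p.1
      set s := η p.1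
      set t := η Λ
      have : 0 ≤ t * (γ * s ^ 2 / 2 + β * s - 1) := by
        have : t * (γ * s ^ 2 / 2 + β * s - 1) = (s - t) * (γ * s * t / 2 + 1) := by
          linear_combination s * hβ
        rw [this]
        exact mul_nonneg (by linarith) (by positivity)
      have := nonneg_of_mul_nonneg_right this b
      linarith
    · right
      constructor
      · exact Filter.mem_of_superset
          (nhds_dom W.etac (a := p.1 - 1) (b := p.1 + 1) (by linarith) (by linarith) q3' q4')
          (fun z hz => ⟨hz.2.2.1, hz.2.2.2⟩)
      have a := W.sol.laplace p.1 p.2 q3' q4'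
      have b1 := dd_quad (W.sm.slx p.2) 0 0 ((-γ / 2) * p.2 ^ 2 + (-β) * p.2 + 0) p.1
      have b2 := dd_quad (W.sm.sly p.1) (-γ / 2) (-β) 0 p.2
      have b1' : pxx (fun x y => ψ x y + ((-γ / 2) * y ^ 2 + (-β) * y + 0)) p.1 p.2
          = pxx ψ p.1 p.2 := by
        have : pxx (fun x y => ψ x y + ((-γ / 2) * y ^ 2 + (-β) * y + 0)) p.1 p.2
          = deriv (deriv (fun t => ψ t p.2 + (0 * t ^ 2 + 0 * t +
            ((-γ / 2) * p.2 ^ 2 + (-β) * p.2 + 0)))) p.1 := by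
          simp only [zero_mul, zero_add]; rfl
        rw [this, b1]; simp; rfl
      change pyy (fun x y => ψ x y + ((-γ / 2) * y ^ 2 + (-β) * y + 0)) p.1 p.2
        = pyy ψ p.1 p.2 + 2 * (-γ / 2) at b2
      rw [b1', b2]; linarith

/-- Bounds derived at the trough. -/
lemma trough (W : StokesWave γ ψ η r Λ) (U : Unidirectional ψ η) (hγ : 0 < γ) {d : ℝ} (hd : 0 < d)
    (hd2 : γ * d ^ 2 = 2) (hr : r ≤ γ + d) :
    ∃ β, 0 ≤ β ∧ β ≤ 2 / γ ∧ γ * (η Λ) ^ 2 / 2 + β * η Λ = 1 ∧ η Λ ≤ d ∧ d - 2 / γ ^ 2 ≤ η Λ ∧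
      γ + d - 2 / γ ^ 2 ≤ r := by
  have ht := W.sol.eta_pos Λ
  obtain ⟨β, hβ⟩ : ∃ β, γ * (η Λ) ^ 2 / 2 + β * η Λ = 1 :=
    ⟨(1 - γ * (η Λ) ^ 2 / 2) / η Λ, by field_simp; ring⟩
  have hle : ∀ {x y : ℝ}, 0 ≤ y → y ≤ η x → ψ x y ≤ γ * y ^ 2 / 2 + β * y :=
    fun h0 h1 => psi_le W hγ hβ h0 h1
  have hdq : ∀ y, HasDerivAt (fun y : ℝ => γ * y ^ 2 / 2 + β * y) (γ * y + β) y := fun y =>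
    ((((hasDerivAt_pow 2 y).const_mul γ).div_const 2).add
      ((hasDerivAt_id y).const_mul β)).congr_deriv (by push_cast; ring)
  -- at the bottom
  have hb0 : 0 ≤ β := by
    have h1 := deriv_nonneg_left (W.sol.eta_pos 0)
      ((hdq 0).sub (W.sm.hdy 0 0)) (fun t ht => by
        have := hle (x := 0) ht.1 ht.2
        have e := W.sol.bottom_val 0
        simp [e]; linarith)
    have h2 := py_nonneg W U (x := 0) le_rfl (W.sol.eta_pos 0).le
    linarith
  have hq : γ * η Λ + β ≤ py ψ Λ (η Λ) := by
    have h1 := deriv_nonneg_right ht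
      ((W.sm.hdy Λ (η Λ)).sub (hdq (η Λ))) (fun t ht => by
        have := hle (x := Λ) ht.1 ht.2
        have e := W.sol.surface_val Λ
        simp only [Pi.sub_apply, e]; linarith)
    linarith
  have hB := W.sol.bernoulli Λ
  set t := η Λ
  have h1 : (γ * t + β) ^ 2 ≤ (py ψ Λ t) ^ 2 := by
    apply pow_le_pow_left₀ (by positivity) hq
  have h2 : γ + β ^ 2 / 2 + t ≤ r := by nlinarith [sq_nonneg (px ψ Λ t)]
  have h3 : t ≤ d := by
    by_contra hc; push Not at hc
    nlinarith [mul_nonneg hb0 ht.le, mul_pos hγ (show 0 < t - d by linarith)]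
  have h4 : γ * (d - t) ≤ β := by
    have : γ * (d - t) * (d + t) = 2 * β * t := by linear_combination hd2 - 2 * hβ
    have h5 : γ * (d - t) * (d + t) ≤ β * (d + t) := by
      rw [this]; nlinarith
    exact le_of_mul_le_mul_right h5 (by linarith)
  have h5 : β ≤ 2 / γ := by
    rw [le_div_iff₀ hγ]
    rcases hb0.eq_or_lt with e | hp
    · rw [← e]; simp
    · have : β * (β * γ) ≤ β * 2 := by nlinarith
      exact le_of_mul_le_mul_left this hp
  have h6 : d - 2 / γ ^ 2 ≤ t := by
    have : d - t ≤ 2 / γ ^ 2 := by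
      rw [le_div_iff₀ (by positivity)]
      rw [le_div_iff₀ hγ] at h5
      nlinarith
    linarith
  exact ⟨β, hb0, h5, hβ, h3, h6, by nlinarith [sq_nonneg β]⟩

lemma oneD (k k1 k2 : ℝ → ℝ) (hk : ∀ y, HasDerivAt k (k1 y) y) (hk1 : ∀ y, HasDerivAt k1 (k2 y) y)
    (a h : ℝ) (ha : 0 < a) (hah : 2 * a ≤ h)
    (hsym : ∀ y, 0 < y → y < a → k2 y ≤ k2 (2 * a - y))
    (hpos : ∀ y, 2 * a < y → y < h → 0 ≤ k2 y) (h0 : k 0 = 0) (h1 : k1 0 ≤ 0) :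
    0 ≤ (h - a) * k1 h - k h := by
  have cp : ∀ {f : ℝ → ℝ} {f' : ℝ} (t : ℝ), HasDerivAt f f' (a + t) →
      HasDerivAt (fun s => f (a + s)) f' t := fun t hf =>
    (HasDerivAt.comp t hf ((hasDerivAt_id t).const_add a)).congr_deriv (by ring)
  have cm : ∀ {f : ℝ → ℝ} {f' : ℝ} (t : ℝ), HasDerivAt f f' (a - t) →
      HasDerivAt (fun s => f (a - s)) (-f') t := fun t hf =>
    (HasDerivAt.comp t hf ((hasDerivAt_id t).const_sub a)).congr_deriv (by ring)
  have hT : ∀ t, HasDerivAt (fun t => t * (k1 (a + t) + k1 (a - t)) - k (a + t) + k (a - t))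
      (t * (k2 (a + t) - k2 (a - t))) t := fun t =>
    ((((hasDerivAt_id t).mul ((cp t (hk1 _)).add (cm t (hk1 _)))).sub (cp t (hk _))).add
      (cm t (hk _))).congr_deriv (by simp; ring)
  have hV : ∀ y, HasDerivAt (fun y => (y - a) * k1 y - k y) ((y - a) * k2 y) y := fun y =>
    ((((hasDerivAt_id y).sub_const a).mul (hk1 y)).sub (hk y)).congr_deriv (by simp)
  have mT := monotoneOn_of_deriv_nonneg (convex_Icc 0 a)
    (fun t _ => (hT t).continuousAt.continuousWithinAt)
    (fun t _ => (hT t).differentiableAt.differentiableWithinAt)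
    (fun t ht => by
      rw [interior_Icc] at ht
      rw [(hT t).deriv]
      have := hsym (a - t) (by linarith [ht.2]) (by linarith [ht.1])
      rw [show 2 * a - (a - t) = a + t by ring] at this
      exact mul_nonneg ht.1.le (by linarith))
  have mV := monotoneOn_of_deriv_nonneg (convex_Icc (2 * a) h)
    (fun t _ => (hV t).continuousAt.continuousWithinAt)
    (fun t _ => (hV t).differentiableAt.differentiableWithinAt)
    (fun t ht => by
      rw [interior_Icc] at ht
      rw [(hV t).deriv]
      exact mul_nonneg (by linarith [ht.1]) (hpos t ht.1 ht.2))
  have i1 := mT (left_mem_Icc.2 ha.le) (right_mem_Icc.2 ha.le) ha.le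
  have i2 := mV (left_mem_Icc.2 hah) (right_mem_Icc.2 hah) hah
  simp only [zero_mul, add_zero, sub_zero, sub_self, h0] at i1
  rw [show a + a = 2 * a by ring] at i1
  simp only at i2
  nlinarith [mul_nonneg ha.le (neg_nonneg.2 h1)]

lemma reflect (W : StokesWave γ ψ η r Λ) (U : Unidirectional ψ η) {a : ℝ} (ha : 2 * a = η Λ)
    {x y : ℝ} (hx0 : 0 ≤ x) (hx1 : x ≤ Λ) (h0 : 0 ≤ y) (h1 : y ≤ a) :
    px ψ x y ≤ px ψ x (2 * a - y) := by
  have hs' : Sm (fun x y => - px ψ x (2 * a - y)) := by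
    have : ContDiff ℝ (⊤ : ℕ∞) (fun p : ℝ × ℝ => px ψ p.1 (2 * a - p.2)) :=
      ContDiff.comp (g := fun p : ℝ × ℝ => px ψ p.1 p.2) W.sm.spx
        (contDiff_fst.prodMk (contDiff_const.sub contDiff_snd))
    exact this.neg
  have hs : Sm (fun x y => px ψ x y + - px ψ x (2 * a - y)) := ContDiff.add W.sm.spx hs'
  have hpos := W.sol.eta_pos Λ
  have key := wmpc hs _ (cpt (continuous_const (y := a)) 0 Λ 0) (fun p hp => ?_) (x, y)
    ⟨hx0, hx1, h0, h1⟩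
  · simp only at key; linarith
  obtain ⟨q1, q2, q3, q4⟩ := hp
  have hm := eta_min W p.1
  rcases q1.eq_or_lt with e | q1'
  · left; rw [← e, px_zero W, px_zero W]; simp
  rcases q2.eq_or_lt with e | q2'
  · left; rw [e, px_lam W, px_lam W]; simp
  rcases q3.eq_or_lt with e | q3'
  · left; rw [← e, px_bot W]
    have := px_nonneg W U q1 q2 (y := 2 * a) (by linarith) (by linarith)
    simpa using this
  rcases q4.eq_or_lt with e | q4'
  · left
    rw [e, show 2 * a - a = a by ring]; simp
  · right
    refine ⟨nhds_dom continuous_const q1' q2' q3' q4', ?_⟩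
    have a1 := harm_px W q3' (show p.2 < η p.1 by linarith)
    have a2 := harm_px W (x := p.1) (y := 2 * a - p.2) (by linarith) (by linarith)
    have b1 := dd_add (W.sm.spx.slx p.2) (hs'.slx p.2) p.1
    have b2 := dd_add (W.sm.spx.sly p.1) (hs'.sly p.1) p.2
    have c1 := dd_neg (fun t => px ψ t (2 * a - p.2)) p.1
    have c2 := dd_neg (fun t => px ψ p.1 (2 * a - t)) p.2
    have c3 : deriv (deriv (fun t => px ψ p.1 (2 * a - t))) p.2
        = pyy (px ψ) p.1 (2 * a - p.2) := by
      have : deriv (fun t => px ψ p.1 (2 * a - t))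
          = fun t => - deriv (fun t => px ψ p.1 t) (2 * a - t) := by
        funext t; exact deriv_comp_const_sub (f := fun t => px ψ p.1 t) _ _
      rw [this, deriv.fun_neg]
      have := deriv_comp_const_sub (f := deriv (fun t => px ψ p.1 t)) (2 * a) p.2
      rw [this, neg_neg]; rfl
    rw [c1] at b1
    rw [c2, c3] at b2
    change pxx (fun x y => px ψ x y + - px ψ x (2 * a - y)) p.1 p.2
      = pxx (px ψ) p.1 p.2 + - pxx (px ψ) p.1 (2 * a - p.2) at b1
    change pyy (fun x y => px ψ x y + - px ψ x (2 * a - y)) p.1 p.2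
      = pyy (px ψ) p.1 p.2 + - pyy (px ψ) p.1 (2 * a - p.2) at b2
    rw [b1, b2]; linarith

/-- The crest inequality. -/
lemma crest_ineq (W : StokesWave γ ψ η r Λ) (U : Unidirectional ψ η) :
    0 ≤ (η 0 - η Λ / 2) * (γ * η 0 - py ψ 0 (η 0)) - (γ * (η 0) ^ 2 / 2 - 1) := by
  have hm := eta_min W 0
  have hpos := W.sol.eta_pos Λ
  have hl := W.lam_pos
  have hpxx : ∀ y, 0 < y → y < η 0 → γ - pyy ψ 0 y = pxx ψ 0 y := fun y h0 h1 => by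
    have := W.sol.laplace 0 y h0 h1
    linarith
  have key := oneD (fun y => γ * y ^ 2 / 2 - ψ 0 y) (fun y => γ * y - py ψ 0 y)
    (fun y => γ - pyy ψ 0 y)
    (fun y => ((((hasDerivAt_pow 2 y).const_mul γ).div_const 2).sub
      (W.sm.hdy 0 y)).congr_deriv (by push_cast; ring))
    (fun y => (((hasDerivAt_id y).const_mul γ).sub
      (W.sm.spy.hdy 0 y)).congr_deriv (by simp; rfl))
    (η Λ / 2) (η 0) (by linarith) (by linarith) ?_ ?_ (by simp [W.sol.bottom_val]) ?_
  · simpa [W.sol.surface_val] using key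
  · intro y h0 h1
    rw [hpxx y h0 (by linarith), hpxx _ (by linarith) (by linarith)]
    have := deriv_nonneg_left hl
      ((W.sm.spx.hdx 0 (2 * (η Λ / 2) - y)).sub (W.sm.spx.hdx 0 y)) (fun t ht => by
        have := reflect W U (a := η Λ / 2) (by ring) ht.1 ht.2 h0.le h1.le
        simp only [Pi.sub_apply, px_zero W]; linarith)
    change 0 ≤ pxx ψ 0 (2 * (η Λ / 2) - y) - pxx ψ 0 y at this
    linarith
  · intro y h0 h1
    rw [hpxx y (by linarith) h1]
    have hev : ∀ᶠ t in nhds (0 : ℝ), y < η t := W.etac.continuousAt.eventually (lt_mem_nhds h1)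
    obtain ⟨ε, hε, hb⟩ := Metric.eventually_nhds_iff.1 hev
    have := deriv_nonneg_left (b := min Λ (ε / 2)) (lt_min hl (by linarith))
      (W.sm.spx.hdx 0 y) (fun t ht => by
        rw [px_zero W]
        refine px_nonneg W U ht.1 (ht.2.trans (min_le_left _ _)) (by linarith) (hb ?_).le
        rw [Real.dist_eq, sub_zero, abs_of_nonneg ht.1]
        have := ht.2.trans (min_le_right _ _)
        linarith)
    exact this
  · have := py_nonneg W U (x := 0) le_rfl (W.sol.eta_pos 0).le
    linarith


lemma psi_le_one (W : StokesWave γ ψ η r Λ) (U : Unidirectional ψ η) {x y : ℝ} (h0 : 0 ≤ y)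
    (h1 : y ≤ η x) : ψ x y ≤ 1 := by
  have m := monotoneOn_of_deriv_nonneg (convex_Icc 0 (η x)) (f := fun t => ψ x t)
    (W.sm.sly x).continuous.continuousOn
    (fun t _ => (W.sm.hdy x t).differentiableAt.differentiableWithinAt)
    (fun t ht => by
      rw [interior_Icc] at ht
      exact py_nonneg W U ht.1.le ht.2.le)
  have := m ⟨h0, h1⟩ ⟨h0.trans h1, le_rfl⟩ h1
  simpa [W.sol.surface_val] using this

lemma dd_cos (A k c x : ℝ) :
    deriv (deriv (fun t => A * cos (k * t) * c)) x = - k ^ 2 * (A * cos (k * x) * c) := by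
  have hk : ∀ t, HasDerivAt (fun t : ℝ => k * t) k t := fun t => by
    simpa using (hasDerivAt_id t).const_mul k
  have h1 : deriv (fun t => A * cos (k * t) * c) = fun t => A * (-sin (k * t) * k) * c := by
    funext t
    exact (((hk t).cos.const_mul A).mul_const c).deriv
  rw [h1]
  have := ((((hk x).sin.neg.mul_const k).const_mul A).mul_const c).deriv
  rw [show (fun t => A * (-sin (k * t) * k) * c) =
    (fun t => A * ((-fun t => sin (k * t)) t * k) * c) from rfl]
  rw [this]; ring

lemma dd_sinh (A k x : ℝ) :
    deriv (deriv (fun t => A * sinh (k * t))) x = k ^ 2 * (A * sinh (k * x)) := by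
  have hk : ∀ t, HasDerivAt (fun t : ℝ => k * t) k t := fun t => by
    simpa using (hasDerivAt_id t).const_mul k
  have h1 : deriv (fun t => A * sinh (k * t)) = fun t => A * (cosh (k * t) * k) := by
    funext t
    exact ((hk t).sinh.const_mul A).deriv
  rw [h1]
  have := (((hk x).cosh.mul_const k).const_mul A).deriv
  rw [this]; ring

lemma thin (W : StokesWave γ ψ η r Λ) (U : Unidirectional ψ η) (hγ : 0 < γ) {β x0 H a : ℝ}
    (hβ0 : 0 ≤ β) (hβ : γ * (η Λ) ^ 2 / 2 + β * η Λ = 1) (hx0 : 0 < x0) (hH : 0 < H)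
    (ha : 0 < a) (haH : a ≤ γ * H ^ 2 / 2 - 1) (hη : ∀ x, -x0 ≤ x → x ≤ x0 → H ≤ η x) :
    a * (π / (2 * x0)) ≤ β * sinh (π / (2 * x0) * H) := by
  set k := π / (2 * x0) with hk
  have hkp : 0 < k := by have := Real.pi_pos; positivity
  have hkx : k * x0 = π / 2 := by rw [hk]; field_simp
  have hsH : 0 < sinh (k * H) := Real.sinh_pos_iff.2 (by positivity)
  set A := a / sinh (k * H) with hA
  have hAp : 0 < A := by positivity
  have hs1 : Sm (fun x y => ψ x y + ((-γ / 2) * y ^ 2 + (-β) * y + 0)) :=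
    ContDiff.add W.sm (by fun_prop)
  have hs2 : Sm (fun x y => A * cos (k * x) * sinh (k * y)) := by
    show ContDiff ℝ (⊤ : ℕ∞) (fun p : ℝ × ℝ => A * cos (k * p.1) * sinh (k * p.2))
    have e1 : ContDiff ℝ (⊤ : ℕ∞) (fun p : ℝ × ℝ => cos (k * p.1)) :=
      Real.contDiff_cos.comp (contDiff_const.mul contDiff_fst)
    have e2 : ContDiff ℝ (⊤ : ℕ∞) (fun p : ℝ × ℝ => sinh (k * p.2)) :=
      Real.contDiff_sinh.comp (contDiff_const.mul contDiff_snd)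
    exact (contDiff_const.mul e1).mul e2
  have hs : Sm (fun x y => (ψ x y + ((-γ / 2) * y ^ 2 + (-β) * y + 0))
      + A * cos (k * x) * sinh (k * y)) := ContDiff.add hs1 hs2
  have key := wmpc hs _ (cpt (continuous_const (y := H)) (-x0) x0 0) (fun p hp => ?_)
  · have h1 : ∀ y ∈ Icc 0 H, ψ 0 y + ((-γ / 2) * y ^ 2 + (-β) * y + 0)
      + A * cos (k * 0) * sinh (k * y) ≤ 0 := fun y hy =>
      key (0, y) ⟨by simp; linarith, hx0.le, hy.1, hy.2⟩
    have hky : HasDerivAt (fun t : ℝ => k * t) k 0 := by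
      simpa using (hasDerivAt_id (0 : ℝ)).const_mul k
    have hd : HasDerivAt (fun y => ψ 0 y + ((-γ / 2) * y ^ 2 + (-β) * y + 0)
      + A * cos (k * 0) * sinh (k * y)) (py ψ 0 0 + (-β) + A * k) 0 :=
      (((W.sm.hdy 0 0).add (((((hasDerivAt_pow 2 (0:ℝ)).const_mul (-γ/2))).add
        ((hasDerivAt_id (0:ℝ)).const_mul (-β))).add_const 0)).add
        (hky.sinh.const_mul (A * cos (k * 0)))).congr_deriv (by simp)
    have h2 := deriv_nonpos_left hH hd (fun t ht => by
      have := h1 t ht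
      simp [W.sol.bottom_val] at this ⊢
      linarith)
    have h3 := py_nonneg W U (x := 0) le_rfl (W.sol.eta_pos 0).le
    have h4 : A * k ≤ β := by linarith
    have : a * k = A * k * sinh (k * H) := by rw [hA]; field_simp
    rw [this]
    exact mul_le_mul_of_nonneg_right h4 hsH.le
  obtain ⟨q1, q2, q3, q4⟩ := hp
  have hm := hη p.1 q1 q2
  have hpl := psi_le W hγ hβ q3 (q4.trans hm)
  rcases q1.eq_or_lt with e | q1'
  · left; rw [← e] at hpl ⊢
    rw [mul_neg, Real.cos_neg, hkx, Real.cos_pi_div_two]; linarith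
  rcases q2.eq_or_lt with e | q2'
  · left; rw [e] at hpl ⊢
    rw [hkx, Real.cos_pi_div_two]; linarith
  rcases q3.eq_or_lt with e | q3'
  · left; rw [← e, W.sol.bottom_val]; simp
  rcases q4.eq_or_lt with e | q4'
  · left
    rw [e]
    have h1 := psi_le_one W U hH.le hm
    have h2 : A * cos (k * p.1) * sinh (k * H) ≤ a := by
      have : A * cos (k * p.1) * sinh (k * H) = a * cos (k * p.1) := by rw [hA]; field_simp
      rw [this]
      nlinarith [Real.cos_le_one (k * p.1)]
    nlinarith [mul_nonneg hβ0 hH.le]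
  · right
    refine ⟨nhds_dom continuous_const q1' q2' q3' q4', ?_⟩
    have a1 := W.sol.laplace p.1 p.2 q3' (q4'.trans_le hm)
    have b1 := dd_add (hs1.slx p.2) (hs2.slx p.2) p.1
    have b2 := dd_add (hs1.sly p.1) (hs2.sly p.1) p.2
    have c1 := dd_quad (W.sm.slx p.2) 0 0 ((-γ / 2) * p.2 ^ 2 + (-β) * p.2 + 0) p.1
    have c2 := dd_quad (W.sm.sly p.1) (-γ / 2) (-β) 0 p.2
    simp only [zero_mul, zero_add] at c1
    rw [c1, dd_cos] at b1
    rw [c2, dd_sinh] at b2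
    have e1 : pxx (fun x y => (ψ x y + ((-γ / 2) * y ^ 2 + (-β) * y + 0))
      + A * cos (k * x) * sinh (k * y)) p.1 p.2 =
      pxx ψ p.1 p.2 + 2 * 0 + -k ^ 2 * (A * cos (k * p.1) * sinh (k * p.2)) := b1
    have e2 : pyy (fun x y => (ψ x y + ((-γ / 2) * y ^ 2 + (-β) * y + 0))
      + A * cos (k * x) * sinh (k * y)) p.1 p.2 =
      pyy ψ p.1 p.2 + 2 * (-γ / 2) + k ^ 2 * (A * cos (k * p.1) * sinh (k * p.2)) := b2
    rw [e1, e2]; linarith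

lemma strip (W : StokesWave γ ψ η r Λ) {x1 : ℝ} (h1 : x1 ≤ Λ) {x y : ℝ}
    (hx : -x1 ≤ x) (hx' : x ≤ x1) (hy0 : η x1 ≤ y) (hy : y ≤ η x) :
    1 - ψ x y ≤ √(2 * r) * x1 := by
  have hsq : 0 ≤ √(2 * r) := Real.sqrt_nonneg _
  have main : ∀ z, 0 ≤ z → z ≤ x1 → y ≤ η z → 1 - ψ z y ≤ √(2 * r) * x1 := by
    intro z z0 z1 hz
    obtain ⟨w, hw, hwy⟩ := intermediate_value_Icc' z1 (W.etac.continuousOn) ⟨hy0, hz⟩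
    have hyp : 0 ≤ y := (W.sol.eta_pos x1).le.trans hy0
    have := (convex_Icc z w).image_sub_le_mul_sub_of_deriv_le (f := fun t => ψ t y)
      (W.sm.slx y).continuous.continuousOn
      (fun t _ => (W.sm.hdx t y).differentiableAt.differentiableWithinAt) (C := √(2 * r))
      (fun t ht => by
        rw [interior_Icc] at ht
        refine px_le W (by linarith [ht.1]) (by linarith [ht.2, hw.2]) hyp ?_
        rw [← hwy]
        exact W.eta_anti.antitoneOn ⟨by linarith [ht.1], by linarith [ht.2, hw.2]⟩
          ⟨by linarith [hw.1], by linarith [hw.2]⟩ ht.2.le)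
      z (left_mem_Icc.2 hw.1) w (right_mem_Icc.2 hw.1) hw.1
    have e : ψ w y = 1 := by rw [← hwy]; exact W.sol.surface_val w
    simp only [e] at this
    refine this.trans ?_
    exact mul_le_mul_of_nonneg_left (by linarith [hw.2]) hsq
  rcases le_total 0 x with h | h
  · exact main x h hx' hy
  · rw [← W.psi_even]
    exact main (-x) (by linarith) (by linarith) (by rwa [W.eta_even])

set_option maxHeartbeats 1000000 in
lemma barrier (W : StokesWave γ ψ η r Λ) (U : Unidirectional ψ η) (hγ : 0 < γ) {d x1 : ℝ}
    (hd : 0 < d) (hd2 : γ * d ^ 2 = 2) (hx1 : 0 ≤ x1) (hx1d : x1 ≤ 0.08 * d) (hxl : x1 ≤ Λ)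
    (he : η x1 = 1.2 * d) (h0 : 1.8 * d ≤ η 0) (hs : √(2 * r) * x1 ≤ 0.17)
    (hr : 1.7 * γ ≤ 2 * (r - 1.8 * d)) : False := by
  set α := 8 / 3 * γ with hα
  set F : ℝ → ℝ → ℝ := fun x y =>
    - ψ x y + (1 - α / 2 * (y - 1.5 * d) ^ 2 + (α + 2 * γ) / 2 * x ^ 2) with hF
  have hsF : Sm F := ContDiff.add (ContDiff.neg W.sm) (by fun_prop)
  have hmc : Continuous (fun x => min (η x) (1.8 * d)) := W.etac.min continuous_const
  have hK := cpt hmc (-x1) x1 (1.2 * d)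
  obtain ⟨xm, hxm, hem⟩ := intermediate_value_Icc' hx1 (W.etac.continuousOn)
    (show 1.5 * d ∈ Icc (η x1) (η 0) by rw [he]; constructor <;> linarith)
  obtain ⟨p, hp, hmax⟩ := hK.exists_isMaxOn
    ⟨(xm, 1.5 * d), by linarith [hxm.1], hxm.2, by simp only; linarith,
      le_min hem.ge (by simp only; linarith)⟩ (f := fun p => F p.1 p.2)
    (ContDiff.continuous hsF).continuousOn
  have hmax' : ∀ x y, -x1 ≤ x → x ≤ x1 → 1.2 * d ≤ y → y ≤ η x → y ≤ 1.8 * d →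
      F x y ≤ F p.1 p.2 := fun x y a1 a2 a3 a4 a5 => hmax (a := (x, y)) ⟨a1, a2, a3, le_min a4 a5⟩
  have hF0 : 0 ≤ F p.1 p.2 := by
    refine le_trans ?_ (hmax' xm (1.5 * d) (by linarith [hxm.1]) hxm.2 (by linarith) hem.ge
      (by linarith))
    have : ψ xm (1.5 * d) = 1 := by rw [← hem]; exact W.sol.surface_val xm
    simp only [hF, this]
    have : 0 ≤ (α + 2 * γ) / 2 * xm ^ 2 := by positivity
    nlinarith
  obtain ⟨q1, q2, q3, q4⟩ := hp
  obtain ⟨x, y⟩ := p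
  simp only at q1 q2 q3 q4 hF0 hmax'
  have q4a : y ≤ η x := q4.trans (min_le_left _ _)
  have q4b : y ≤ 1.8 * d := q4.trans (min_le_right _ _)
  have hst := strip W hxl q1 q2 (by rw [he]; exact q3) q4a
  have hx2 : x ^ 2 ≤ (0.08 * d) ^ 2 := by
    apply sq_le_sq' <;> linarith
  have hX : γ * x ^ 2 ≤ 0.0128 := by nlinarith
  have hy2 : γ * (y - 1.5 * d) ^ 2 ≤ 0.1725 := by
    simp only [hF, hα] at hF0
    nlinarith
  have hL : ∀ s, s ^ 2 = (0.3 * d) ^ 2 → ¬ γ * s ^ 2 ≤ 0.1725 := by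
    intro s hs h
    rw [hs] at h
    nlinarith
  have q3' : 1.2 * d < y := by
    rcases q3.eq_or_lt with e | h
    · exact absurd hy2 (hL _ (by rw [← e]; ring))
    · exact h
  have q4b' : y < 1.8 * d := by
    rcases q4b.eq_or_lt with e | h
    · exact absurd hy2 (hL _ (by rw [e]; ring))
    · exact h
  have q1' : -x1 < x := by
    rcases q1.eq_or_lt with e | h
    · rw [← e, W.eta_even, he] at q4a; linarith
    · exact h
  have q2' : x < x1 := by
    rcases q2.eq_or_lt with e | h
    · rw [e, he] at q4a; linarith
    · exact h
  rcases q4a.eq_or_lt with e | q4'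
  · -- surface point
    have hv := deriv_nonneg_right q3' (hsF.hdy x y) (fun t ht =>
      hmax' x t q1 q2 ht.1 (ht.2.trans q4a) (ht.2.trans q4b))
    have hsq : ∀ t, HasDerivAt (fun t : ℝ => t ^ 2) (2 * t) t := fun t => by
      simpa using hasDerivAt_pow 2 t
    have hsq2 : ∀ t c, HasDerivAt (fun t : ℝ => (t - c) ^ 2) (2 * (t - c)) t := fun t c => by
      have := ((hasDerivAt_id t).sub_const c).fun_pow 2
      simpa using this
    have hFy : py F x y = - py ψ x y - α * (y - 1.5 * d) := by
      have := (W.sm.hdy x y).neg.add ((((hsq2 y (1.5 * d)).const_mul (α / 2)).const_sub 1).add_const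
        ((α + 2 * γ) / 2 * x ^ 2))
      have h2 := (hsF.hdy x y).unique this
      rw [h2]; ring
    have hFx : px F x y = - px ψ x y + (α + 2 * γ) * x := by
      have := (W.sm.hdx x y).neg.add ((((hsq x).const_mul ((α + 2 * γ) / 2)).const_add
        (1 - α / 2 * (y - 1.5 * d) ^ 2)))
      have h2 := (hsF.hdx x y).unique this
      rw [h2]; ring
    have hη : HasDerivAt η (deriv η x) x :=
      ((W.sol.eta_smooth.differentiable (by simp)) x).hasDerivAt
    have hal := hsF.along hη
    have hloc : IsLocalMax (fun t => F t (η t)) x := by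
      have e1 : ∀ᶠ t in nhds x, -x1 < t := lt_mem_nhds q1'
      have e2 : ∀ᶠ t in nhds x, t < x1 := gt_mem_nhds q2'
      have e3 : ∀ᶠ t in nhds x, 1.2 * d < η t :=
        W.etac.continuousAt.eventually (lt_mem_nhds (by rw [← e]; exact q3'))
      have e4 : ∀ᶠ t in nhds x, η t < 1.8 * d :=
        W.etac.continuousAt.eventually (gt_mem_nhds (by rw [← e]; exact q4b'))
      filter_upwards [e1, e2, e3, e4] with t t1 t2 t3 t4
      rw [← e]
      exact hmax' t (η t) t1.le t2.le t3.le le_rfl t4.le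
    have hz := hloc.hasDerivAt_eq_zero hal
    have hsu := px_surf W x
    have hB := W.sol.bernoulli x
    have hpy := py_nonneg W U (x := x) (y := y) (by linarith) q4a
    rw [← e] at hz hsu hB
    rw [hFy] at hv hz
    rw [hFx] at hz
    set a := px ψ x y
    set b := py ψ x y
    set m := deriv η x
    set Y := - α * (y - 1.5 * d) with hY
    have hbY : b ≤ Y := by rw [hY]; linarith
    have hXY : (α + 2 * γ) * x = - m * Y := by rw [hY]; linarith
    have ha : a = - m * b := by linarith
    have hb2 : b ^ 2 ≤ Y ^ 2 := pow_le_pow_left₀ hpy hbY 2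
    have hmb : m ^ 2 * b ^ 2 ≤ m ^ 2 * Y ^ 2 := mul_le_mul_of_nonneg_left hb2 (sq_nonneg m)
    have hsum : a ^ 2 + b ^ 2 ≤ ((α + 2 * γ) * x) ^ 2 + Y ^ 2 := by
      rw [hXY, ha, mul_pow, mul_pow, neg_sq]; linarith
    have hY2 : Y ^ 2 = 64 / 9 * γ * (γ * (y - 1.5 * d) ^ 2) := by rw [hY, hα]; ring
    have hX2 : ((α + 2 * γ) * x) ^ 2 = 196 / 9 * γ * (γ * x ^ 2) := by rw [hα]; ring
    rw [hY2, hX2] at hsum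
    have i1 := mul_le_mul_of_nonneg_left hy2 (show 0 ≤ 64 / 9 * γ by positivity)
    have i2 := mul_le_mul_of_nonneg_left hX (show 0 ≤ 196 / 9 * γ by positivity)
    linarith
  · have hnh : {p : ℝ × ℝ | -x1 ≤ p.1 ∧ p.1 ≤ x1 ∧ 1.2 * d ≤ p.2 ∧ p.2 ≤ min (η p.1) (1.8 * d)}
        ∈ nhds (x, y) :=
      nhds_dom hmc q1' q2' q3' (lt_min q4' q4b')
    have hloc : ∀ᶠ z in nhds (x, y), F z.1 z.2 ≤ F x y := by
      filter_upwards [hnh] with z hz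
      exact hmax hz
    have lx : IsLocalMax (fun t => F t y) x :=
      ((Continuous.prodMk_left y).continuousAt (x := x)).eventually hloc
    have ly : IsLocalMax (fun t => F x t) y :=
      ((Continuous.prodMk_right x).continuousAt (x := y)).eventually hloc
    have d1 := dd_nonpos (hsF.slx y).continuous.continuousAt lx
    have d2 := dd_nonpos (hsF.sly x).continuous.continuousAt ly
    have hsn : Sm (fun x y => - ψ x y) := ContDiff.neg W.sm
    have c1 := dd_quad (hsn.slx y) ((α + 2 * γ) / 2) 0 (1 - α / 2 * (y - 1.5 * d) ^ 2) x
    have c2 := dd_quad (hsn.sly x) (-α / 2) (α * 1.5 * d)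
      (1 - α / 2 * (1.5 * d) ^ 2 + (α + 2 * γ) / 2 * x ^ 2) y
    rw [dd_neg] at c1 c2
    have g1 : (fun t => F t y) = fun t => -ψ t y + ((α + 2 * γ) / 2 * t ^ 2 + 0 * t +
        (1 - α / 2 * (y - 1.5 * d) ^ 2)) := by funext t; simp only [hF]; ring
    have g2 : (fun t => F x t) = fun t => -ψ x t + (-α / 2 * t ^ 2 + α * 1.5 * d * t +
        (1 - α / 2 * (1.5 * d) ^ 2 + (α + 2 * γ) / 2 * x ^ 2)) := by
      funext t; simp only [hF]; ring
    rw [g1, c1] at d1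
    rw [g2, c2] at d2
    have a1 := W.sol.laplace x y (by linarith) q4'
    change -pxx ψ x y + _ ≤ 0 at d1
    change -pyy ψ x y + _ ≤ 0 at d2
    linarith

lemma coarse (W : StokesWave γ ψ η r Λ) (U : Unidirectional ψ η) {d : ℝ}
    (hγ : 10 ^ 6 + sinh (7.5 * π) < γ) (hd : 0 < d) (hd2 : γ * d ^ 2 = 2) (hr : r ≤ γ + d) :
    η 0 < 1.8 * d := by
  have hS : 0 < sinh (7.5 * π) := Real.sinh_pos_iff.2 (by have := Real.pi_pos; positivity)
  have hγ6 : 10 ^ 6 < γ := by linarith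
  have hγ0 : 0 < γ := by linarith
  obtain ⟨β, hβ0, hβ2, hβ, ht, ht', hr'⟩ := trough W U hγ0 hd hd2 hr
  have hd1 : d ≤ 0.01 := by
    by_contra hc; push Not at hc
    nlinarith
  by_contra hcon
  push Not at hcon
  obtain ⟨x1, hx1, he⟩ := intermediate_value_Icc' W.lam_pos.le (W.etac.continuousOn)
    (show 1.2 * d ∈ Icc (η Λ) (η 0) by constructor <;> linarith)
  have hthin : x1 ≤ 0.08 * d := by
    by_contra hc; push Not at hc
    have h1 : ∀ x, -(0.08 * d) ≤ x → x ≤ 0.08 * d → 1.2 * d ≤ η x := by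
      have main : ∀ z, 0 ≤ z → z ≤ 0.08 * d → 1.2 * d ≤ η z := fun z z0 z1 => by
        rw [← he]
        exact W.eta_anti.antitoneOn ⟨z0, by linarith [hx1.2]⟩ hx1 (by linarith)
      intro x a b
      rcases le_total 0 x with h | h
      · exact main x h b
      · rw [← W.eta_even]; exact main (-x) (by linarith) (by linarith)
    have h2 := thin W U hγ0 (x0 := 0.08 * d) (H := 1.2 * d) (a := 0.44) hβ0 hβ (by linarith)
      (by linarith) (by norm_num) (by nlinarith) h1
    have e1 : π / (2 * (0.08 * d)) * (1.2 * d) = 7.5 * π := by field_simp; norm_num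
    rw [e1] at h2
    have h3 : (2 : ℝ) ≤ 0.44 * (π / (2 * (0.08 * d))) := by
      rw [← mul_div_assoc, le_div_iff₀ (by linarith)]
      have := Real.pi_gt_three
      linarith
    have h4 : β * sinh (7.5 * π) ≤ 2 / γ * sinh (7.5 * π) :=
      mul_le_mul_of_nonneg_right hβ2 hS.le
    have h5 : 2 ≤ 2 / γ * sinh (7.5 * π) := h3.trans (h2.trans h4)
    rw [div_mul_eq_mul_div, le_div_iff₀ hγ0] at h5
    linarith
  have hr0 := r_pos W
  refine barrier W U hγ0 hd hd2 hx1.1 hthin hx1.2 he hcon ?_ ?_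
  · have hsq := Real.sq_sqrt (show 0 ≤ 2 * r by linarith)
    have hsn := Real.sqrt_nonneg (2 * r)
    have h1 : √(2 * r) * x1 ≤ √(2 * r) * (0.08 * d) := mul_le_mul_of_nonneg_left hthin hsn
    have h2 : (√(2 * r) * (0.08 * d)) ^ 2 ≤ 0.17 ^ 2 := by
      rw [mul_pow, hsq]
      have : r * d ^ 2 ≤ (γ + d) * d ^ 2 := mul_le_mul_of_nonneg_right hr (sq_nonneg d)
      nlinarith
    have h3 := (pow_le_pow_iff_left₀ (by positivity) (by norm_num) (by norm_num)).1 h2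
    linarith
  · have : 2 / γ ^ 2 ≤ 1 := by
      rw [div_le_one (by positivity)]; nlinarith
    linarith

set_option maxHeartbeats 1000000 in
lemma fine_alg {γ d s h t q : ℝ} (hγ : 10 ^ 6 < γ) (hd : 0 < d) (hd2 : γ * d ^ 2 = 2)
    (hs : s = γ * d) (hq : 0 ≤ q) (hq2 : 2 * γ - 2 * (h - d) - 4 / γ ^ 2 ≤ q ^ 2)
    (ht1 : t ≤ d) (ht2 : d - 2 / γ ^ 2 ≤ t) (hh : h < 1.8 * d) (hth : t ≤ h) (ht0 : 0 < t)
    (hc : 0 ≤ (h - t / 2) * (γ * h - q) - (γ * h ^ 2 / 2 - 1)) :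
    γ ^ 3 * s * (h - d) ≤ 120 ∧ γ ^ 2 * s * (s - q) ≤ 244 := by
  have hγ0 : 0 < γ := by linarith
  have hd1 : d ≤ 0.01 := by
    by_contra hc; push Not at hc
    nlinarith
  obtain ⟨i, hi⟩ : ∃ i, i = 1 / γ ^ 2 := ⟨_, rfl⟩
  have hi1 : γ ^ 2 * i = 1 := by rw [hi]; field_simp
  have hi0 : 0 < i := by rw [hi]; positivity
  rw [show 4 / γ ^ 2 = 4 * i by rw [hi]; ring] at hq2
  rw [show 2 / γ ^ 2 = 2 * i by rw [hi]; ring] at ht2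
  have hs0 : 0 < s := by rw [hs]; positivity
  have hs2 : s ^ 2 = 2 * γ := by rw [hs]; linear_combination γ * hd2
  have hid : i ≤ 0.01 * d := by
    have h1 : γ * i ≤ 10 ^ (-6 : ℤ) := by
      have : γ * (γ * i) = 1 := by rw [← hi1]; ring
      by_contra hc; push Not at hc
      norm_num at hc
      nlinarith
    have h2 : 2 ≤ γ * d := by nlinarith
    norm_num at h1
    by_contra hc; push Not at hc
    nlinarith
  have hs1000 : 1000 ≤ s := by
    by_contra hc; push Not at hc
    nlinarith
  obtain ⟨δ, hδ⟩ : ∃ δ, δ = h - d := ⟨_, rfl⟩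
  have hhd : h = d + δ := by linarith
  rw [← hδ] at hq2 ⊢
  have hsp : s * (s - q) ≤ 4 * i + 2 * max δ 0 := by
    have hm1 := le_max_left δ 0
    have hm2 := le_max_right δ 0
    rcases le_total s q with h1 | h1
    · nlinarith [mul_nonneg hs0.le (sub_nonneg.2 h1)]
    · nlinarith [mul_nonneg hq (sub_nonneg.2 h1)]
  have hA : γ ^ 3 * s * δ ≤ 120 := by
    rcases le_or_gt δ 0 with hn | hp
    · nlinarith [mul_nonneg (show 0 ≤ γ ^ 3 * s by positivity) (neg_nonneg.2 hn)]
    rw [max_eq_left hp.le] at hsp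
    obtain ⟨P, hP⟩ : ∃ P, P = (4 * i + 2 * δ) / s := ⟨_, rfl⟩
    have hPs : s * P = 4 * i + 2 * δ := by rw [hP]; field_simp
    have hP0 : 0 ≤ P := by rw [hP]; positivity
    have hpP : s - q ≤ P := by
      by_contra hc; push Not at hc
      nlinarith
    have e1 : γ * h - q = γ * δ + (s - q) := by rw [hhd, hs]; ring
    have e2 : γ * h ^ 2 / 2 - 1 = γ * d * δ + γ * δ ^ 2 / 2 := by
      rw [hhd]; linear_combination hd2 / 2
    rw [e1, e2] at hc
    have i1 : (h - t / 2) * (γ * δ + (s - q)) ≤ (h - t / 2) * (γ * δ + P) :=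
      mul_le_mul_of_nonneg_left (by linarith) (by linarith)
    have i2 : (h - t / 2) * (γ * δ + P) ≤ (d / 2 + δ + i) * (γ * δ + P) :=
      mul_le_mul_of_nonneg_right (by linarith) (by positivity)
    have i3 : γ * δ * (d / 2 - δ / 2 - i) ≤ (d / 2 + δ + i) * P := by linarith
    have i4 : γ * δ * (0.09 * d) ≤ γ * δ * (d / 2 - δ / 2 - i) :=
      mul_le_mul_of_nonneg_left (by linarith) (by positivity)
    have i5 : (d / 2 + δ + i) * P ≤ (1.31 * d) * P :=
      mul_le_mul_of_nonneg_right (by linarith) hP0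
    have i6 : γ * δ * 0.09 ≤ 1.31 * P := by
      refine le_of_mul_le_mul_right ?_ hd
      linarith
    have i7 : s * (γ * δ * 0.09) ≤ s * (1.31 * P) := mul_le_mul_of_nonneg_left i6 hs0.le
    have i8 : γ * s * δ ≤ 60 * i + 30 * δ := by linarith
    have i9 : 60 * δ ≤ γ * s * δ := mul_le_mul_of_nonneg_right (by nlinarith) hp.le
    have i10 : γ * s * δ ≤ 120 * i := by linarith
    have i11 : γ ^ 2 * (γ * s * δ) ≤ γ ^ 2 * (120 * i) :=
      mul_le_mul_of_nonneg_left i10 (by positivity)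
    linarith
  refine ⟨hA, ?_⟩
  have j1 : γ ^ 2 * (s * (s - q)) ≤ γ ^ 2 * (4 * i + 2 * max δ 0) :=
    mul_le_mul_of_nonneg_left hsp (by positivity)
  have j2 : γ ^ 2 * max δ 0 ≤ 120 := by
    rcases le_or_gt δ 0 with hn | hp
    · rw [max_eq_right hn]; norm_num
    · rw [max_eq_left hp.le]
      have : (γ ^ 2 * δ) * 1 ≤ (γ ^ 2 * δ) * (γ * s) :=
        mul_le_mul_of_nonneg_left (by nlinarith) (by positivity)
      linarith
  linarith

end wave

/-- Theorem 1.1 (ii): at the crest, `ψ_y ≥ √(2γ) - C γ^(-5/2)` and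
`η̂ ≤ √(2/γ) + C γ^(-7/2)`. -/
theorem crest_bounds :
    ∃ C > (0 : ℝ), ∃ γ₀ > (0 : ℝ), ∀ γ > γ₀,
      ∀ (ψ : ℝ → ℝ → ℝ) (η : ℝ → ℝ) (r Λ sc : ℝ),
        StokesWave γ ψ η r Λ → Unidirectional ψ η → IsCrit γ sc →
        bernR γ sc < r → r ≤ bernR γ 0 →
        py ψ 0 (η 0) ≥ Real.sqrt (2 * γ) - C * γ ^ (-(5 : ℝ) / 2) ∧
        η 0 ≤ Real.sqrt (2 / γ) + C * γ ^ (-(7 : ℝ) / 2) := by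
  refine ⟨1000, by norm_num, 10 ^ 6 + sinh (7.5 * π), ?_, ?_⟩
  · have hS : 0 < sinh (7.5 * π) := Real.sinh_pos_iff.2 (by have := Real.pi_pos; positivity)
    linarith
  intro γ hγ ψ η r Λ sc W U _ _ hr
  have hS : 0 < sinh (7.5 * π) := Real.sinh_pos_iff.2 (by have := Real.pi_pos; positivity)
  have hγ6 : 10 ^ 6 < γ := by linarith
  have hγ0 : 0 < γ := by linarith
  obtain ⟨d, hd⟩ : ∃ d, d = √(2 / γ) := ⟨_, rfl⟩
  have hd0 : 0 < d := by rw [hd]; positivity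
  have hd2 : γ * d ^ 2 = 2 := by rw [hd, Real.sq_sqrt (by positivity)]; field_simp
  have hs : √(2 * γ) = γ * d := by
    rw [Real.sqrt_eq_iff_mul_self_eq (by positivity) (by positivity)]
    linear_combination -γ * hd2
  have hr2 : r ≤ γ + d := by
    have : bernR γ 0 = γ + d := by
      unfold bernR lamDepth
      have : √((0 : ℝ) ^ 2 + 2 * γ) = γ * d := by rw [← hs]; congr 1; ring
      rw [this]; field_simp; ring
    linarith
  have hco := coarse W U hγ hd0 hd2 hr2
  obtain ⟨β, -, -, -, ht, ht', hr'⟩ := trough W U hγ0 hd0 hd2 hr2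
  have hB := W.sol.bernoulli 0
  rw [px_zero W] at hB
  obtain ⟨f1, f2⟩ := fine_alg hγ6 hd0 hd2 rfl
    (py_nonneg W U (x := 0) (W.sol.eta_pos 0).le le_rfl)
    (by have : 4 / γ ^ 2 = 2 * (2 / γ ^ 2) := by ring
        linarith)
    ht ht' hco (eta_min W 0) (W.sol.eta_pos Λ) (crest_ineq W U)
  obtain ⟨g, hg⟩ : ∃ g, g = √γ := ⟨_, rfl⟩
  have hg0 : 0 < g := by rw [hg]; positivity
  have hg2 : γ = g ^ 2 := by rw [hg, Real.sq_sqrt hγ0.le]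
  have hpow : ∀ n : ℕ, γ ^ (-(n : ℝ) / 2) = 1 / g ^ n := by
    intro n
    rw [show -(n : ℝ) / 2 = (1 / 2) * (-(n : ℝ)) by ring, Real.rpow_mul hγ0.le,
      ← Real.sqrt_eq_rpow, ← hg, Real.rpow_neg hg0.le, Real.rpow_natCast, one_div]
  have p5 := hpow 5
  have p7 := hpow 7
  push_cast at p5 p7
  rw [p5, p7, hs, ← hd]
  have hgs : g ≤ γ * d := by
    have h1 : g ^ 2 ≤ (γ * d) ^ 2 := by
      rw [← hg2, mul_pow]; nlinarith
    exact (pow_le_pow_iff_left₀ hg0.le (by positivity) (by norm_num)).1 h1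
  have key : ∀ (n : ℕ) (z c : ℝ), c ≤ 1000 → γ ^ n * (γ * d) * z ≤ c →
      z ≤ 1000 * (1 / g ^ (2 * n + 1)) := by
    intro n z c hc hz
    rw [mul_one_div, le_div_iff₀ (by positivity)]
    rcases le_total z 0 with h | h
    · nlinarith [mul_nonneg (neg_nonneg.2 h) (pow_pos hg0 (2 * n + 1)).le]
    · have e : g ^ (2 * n + 1) = γ ^ n * g := by rw [pow_succ, pow_mul, ← hg2]
      rw [e]
      have h2 : γ ^ n * g * z ≤ γ ^ n * (γ * d) * z := by gcongr
      linarith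
  have k5 := key 2 _ _ (by norm_num) f2
  have k7 := key 3 _ _ (by norm_num) f1
  norm_num at k5 k7 ⊢
  constructor <;> linarith
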